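/- arXiv:1502.01563 — 2 statements merged into one kernel-verified Lean document; each statement's English description precedes it below -/
import Mathlib

section
/- For every ε > 0, the Frank–Wolfe algorithm with the predefined stepsize rule produces an ε-approximate solution after at most O(1/ε) iterations: precisely, for every k ≥ 1 with k ≥ 4·C_f/ε − 2 one has f(α^(k)) − f(α*) ≤ ε, where α* is any minimizer of f over Σ. -/
open scoped RealInnerProductSpace

/-- First-order characterization of convexity: a convex function lies above its tangents. -/
theorem ConvexOn.add_inner_gradient_le {E : Type*} [NormedAddCommGroup E] [InnerProductSpace ℝ E]
    [CompleteSpace E] {f : E → ℝ} (hf : ConvexOn ℝ Set.univ f) {x g : E}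
    (hg : HasGradientAt f g x) (y : E) : f x + ⟪y - x, g⟫ ≤ f y := by
  have hline : ConvexOn ℝ Set.univ (f ∘ AffineMap.lineMap (k := ℝ) x y) := by
    simpa using hf.comp_affineMap (AffineMap.lineMap (k := ℝ) x y)
  have hderiv : HasDerivAt (f ∘ AffineMap.lineMap (k := ℝ) x y) ⟪g, y - x⟫ 0 := by
    have hg' : HasFDerivAt f (InnerProductSpace.toDual ℝ E g)
        (AffineMap.lineMap (k := ℝ) x y 0) := by
      simpa using hg.hasFDerivAt
    simpa using hg'.comp_hasDerivAt (0 : ℝ) AffineMap.hasDerivAt_lineMap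
  have h := hline.le_slope_of_hasDerivAt (Set.mem_univ 0) (Set.mem_univ 1) zero_lt_one hderiv
  simp only [slope_def_field, Function.comp_apply, AffineMap.lineMap_apply_zero,
    AffineMap.lineMap_apply_one, sub_zero, div_one] at h
  rw [real_inner_comm]
  linarith

/-- A nonnegative constant `C` and the recursion `h (k + 1) ≤ (1 - λ) h k + λ ^ 2 / 2 * C` with
`λ = 2 / (k + 2)` force `h k ≤ 2 C / (k + 2)` from `k = 1` on. -/
theorem le_two_mul_div_of_frankWolfe_recursion {h : ℕ → ℝ} {C : ℝ} (hC : 0 ≤ C)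
    (hrec : ∀ k : ℕ, h (k + 1) ≤
      (1 - 2 / ((k : ℝ) + 2)) * h k + (2 / ((k : ℝ) + 2)) ^ 2 / 2 * C)
    {k : ℕ} (hk : 1 ≤ k) : h k ≤ 2 * C / ((k : ℝ) + 2) := by
  induction k, hk using Nat.le_induction with
  | base =>
    have := hrec 0
    norm_num at this ⊢
    linarith
  | succ k _ ih =>
    have hcoef : 1 - 2 / ((k : ℝ) + 2) = k / (k + 2) := by field_simp; ring
    calc h (k + 1)
        ≤ k / (k + 2) * h k + (2 / ((k : ℝ) + 2)) ^ 2 / 2 * C := hcoef ▸ hrec k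
      _ ≤ k / (k + 2) * (2 * C / (k + 2)) + (2 / ((k : ℝ) + 2)) ^ 2 / 2 * C := by gcongr
      _ = 2 * C * ((k + 1) / (k + 2) ^ 2) := by field_simp
      _ ≤ 2 * C * (1 / (k + 3)) := by
        gcongr 2 * C * ?_
        rw [div_le_div_iff₀ (by positivity) (by positivity)]
        nlinarith
      _ = 2 * C / (((k + 1 : ℕ) : ℝ) + 2) := by push_cast; ring

/-- `O(1/ε)` iteration complexity of the Frank–Wolfe algorithm with the
predefined stepsize rule: for every `ε > 0` and every `k ≥ 1` with
`k ≥ 4 C_f / ε − 2`, the iterate `α^(k)` is an `ε`-approximate solution. -/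
theorem fw_eps_approximate_solution_complexity
    {m : ℕ} (S : Set (EuclideanSpace ℝ (Fin m)))
    (hSne : S.Nonempty) (hScomp : IsCompact S) (hSconv : Convex ℝ S)
    (f : EuclideanSpace ℝ (Fin m) → ℝ)
    (g : EuclideanSpace ℝ (Fin m) → EuclideanSpace ℝ (Fin m))
    (hfconv : ConvexOn ℝ Set.univ f)
    (hgrad : ∀ x, HasGradientAt f (g x) x)
    (Cf : ℝ)
    (hCf : ∀ x ∈ S, ∀ s ∈ S, ∀ γ ∈ Set.Ioc (0:ℝ) 1,
      f (x + γ • (s - x)) - f x - ⟪γ • (s - x), g x⟫ ≤ γ ^ 2 / 2 * Cf)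
    (α u : ℕ → EuclideanSpace ℝ (Fin m))
    (hα0 : α 0 ∈ S)
    (huS : ∀ k, u k ∈ S)
    (humin : ∀ k, ∀ v ∈ S, ⟪u k - α k, g (α k)⟫ ≤ ⟪v - α k, g (α k)⟫)
    (hstep : ∀ k : ℕ, α (k + 1) = α k + (2 / ((k : ℝ) + 2)) • (u k - α k))
    (αstar : EuclideanSpace ℝ (Fin m))
    (hαstar : αstar ∈ S) (hmin : ∀ v ∈ S, f αstar ≤ f v) :
    ∀ ε : ℝ, 0 < ε → ∀ k : ℕ, 1 ≤ k → 4 * Cf / ε - 2 ≤ (k : ℝ) →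
      f (α k) - f αstar ≤ ε := by
  have hC : 0 ≤ Cf := by
    obtain ⟨x, hx⟩ := hSne
    have := hCf x hx x hx 1 (by simp)
    simp at this
    linarith
  have hlam : ∀ k : ℕ, 2 / ((k : ℝ) + 2) ∈ Set.Ioc (0 : ℝ) 1 := fun k =>
    ⟨by positivity, (div_le_one (by positivity)).2 (by linarith [k.cast_nonneg (α := ℝ)])⟩
  have hαS : ∀ k, α k ∈ S := by
    intro k
    induction k with
    | zero => exact hα0
    | succ k ih =>
      rw [hstep]
      exact hSconv.add_smul_sub_mem ih (huS k) ⟨(hlam k).1.le, (hlam k).2⟩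
  have hrec : ∀ k : ℕ, f (α (k + 1)) - f αstar ≤
      (1 - 2 / ((k : ℝ) + 2)) * (f (α k) - f αstar) + (2 / ((k : ℝ) + 2)) ^ 2 / 2 * Cf := by
    intro k
    have hcurv := hCf (α k) (hαS k) (u k) (huS k) _ (hlam k)
    rw [← hstep, real_inner_smul_left] at hcurv
    have hgap : ⟪u k - α k, g (α k)⟫ ≤ f αstar - f (α k) := by
      linarith [humin k αstar hαstar, hfconv.add_inner_gradient_le (hgrad (α k)) αstar]
    linarith [mul_le_mul_of_nonneg_left hgap (hlam k).1.le]
  intro ε hε k hk hkε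
  have hbound : 4 * Cf ≤ (k + 2) * ε := (div_le_iff₀ hε).1 (by linarith)
  calc f (α k) - f αstar ≤ 2 * Cf / (k + 2) :=
        le_two_mul_div_of_frankWolfe_recursion (h := fun k => f (α k) - f αstar) hC hrec hk
    _ ≤ ε := (div_le_iff₀ (by positivity)).2 (by linarith)
end

section
/- Sparse approximate solutions of the ℓ1-constrained Lasso problem exist with O(1/ε) active features: let t > 0, let Σ = {α ∈ ℝ^m : ‖α‖₁ ≤ t}, let f : ℝ^m → ℝ be convex and differentiable with finite curvature constant C_f over Σ. Then for every ε > 0 there exists α ∈ Σ whose number of nonzero coordinates is at most ⌈4·C_f/ε⌉ + 1 and such that f(α) − min_{β∈Σ} f(β) ≤ ε. -/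
open scoped RealInnerProductSpace

/-- First-order characterisation of convexity: the linearisation of a convex function at a point
is a global minorant. -/
theorem ConvexOn.inner_gradient_le_sub {E : Type*} [NormedAddCommGroup E] [InnerProductSpace ℝ E]
    [CompleteSpace E] {f : E → ℝ} (hf : ConvexOn ℝ Set.univ f) {x g : E}
    (hg : HasGradientAt f g x) (z : E) : ⟪z - x, g⟫ ≤ f z - f x := by
  have hconv : ConvexOn ℝ Set.univ (f ∘ AffineMap.lineMap (k := ℝ) x z) := by
    simpa using hf.comp_affineMap (AffineMap.lineMap (k := ℝ) x z)
  have hderiv : HasDerivAt (f ∘ AffineMap.lineMap (k := ℝ) x z) ⟪z - x, g⟫ 0 := by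
    have hfd : HasFDerivAt f (InnerProductSpace.toDual ℝ E g)
        (AffineMap.lineMap (k := ℝ) x z 0) := by
      simpa using hg.hasFDerivAt
    have hcomp := hfd.comp_hasDerivAt (0 : ℝ) AffineMap.hasDerivAt_lineMap
    rwa [InnerProductSpace.toDual_apply_apply, real_inner_comm] at hcomp
  simpa [slope_def_field] using
    hconv.le_slope_of_hasDerivAt (Set.mem_univ 0) (Set.mem_univ 1) one_pos hderiv

/-- A linear functional attains its minimum over the `ℓ1`-ball at a vector with at most one
nonzero coordinate. -/
theorem exists_sparse_inner_minimizer_l1Ball {ι : Type*} [Fintype ι] {t : ℝ} (ht : 0 ≤ t)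
    (g : EuclideanSpace ℝ ι) :
    ∃ s : EuclideanSpace ℝ ι, ∑ i, |s i| ≤ t ∧
      (Finset.univ.filter fun i => s i ≠ 0).card ≤ 1 ∧
      ∀ z : EuclideanSpace ℝ ι, ∑ i, |z i| ≤ t → ⟪s, g⟫ ≤ ⟪z, g⟫ := by
  classical
  rcases isEmpty_or_nonempty ι with hι | hι
  · exact ⟨0, by simpa using ht, by simp, fun z _ => by simp [PiLp.inner_apply]⟩
  obtain ⟨i, hi⟩ := Finite.exists_max fun i => |g i|
  have habs : |-(t * SignType.sign (g i))| ≤ t := by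
    rcases lt_trichotomy (g i) 0 with h | h | h <;> simp [h, abs_of_nonneg ht, ht]
  refine ⟨EuclideanSpace.single i (-(t * SignType.sign (g i))), ?_, ?_, fun z hz => ?_⟩
  · simpa [PiLp.single_apply, apply_ite abs] using habs
  · refine (Finset.card_le_card (t := {i}) fun j hj => ?_).trans (Finset.card_singleton i).le
    by_contra hji
    simp_all
  · have hleft : ⟪EuclideanSpace.single i (-(t * SignType.sign (g i) : ℝ)), g⟫ = -(t * |g i|) := by
      rw [EuclideanSpace.inner_single_left, ← sign_mul_self (g i)]
      simp [mul_assoc]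
    rw [hleft, PiLp.inner_apply]
    calc -(t * |g i|) ≤ -((∑ j, |z j|) * |g i|) := by gcongr
      _ = ∑ j, -(|z j| * |g i|) := by rw [Finset.sum_mul, Finset.sum_neg_distrib]
      _ ≤ ∑ j, ⟪z j, g j⟫ := by
        refine Finset.sum_le_sum fun j _ => ?_
        have hj : |z j * g j| ≤ |z j| * |g i| := by
          rw [abs_mul]
          exact mul_le_mul_of_nonneg_left (hi j) (abs_nonneg _)
        simpa [mul_comm] using (abs_le.mp hj).1

theorem convex_l1Ball {ι : Type*} [Fintype ι] (t : ℝ) :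
    Convex ℝ {α : EuclideanSpace ℝ ι | ∑ i, |α i| ≤ t} := by
  intro x hx y hy a b ha hb hab
  simp only [Set.mem_ofPred_eq] at hx hy ⊢
  calc ∑ i, |(a • x + b • y) i| ≤ ∑ i, (a * |x i| + b * |y i|) := by
        refine Finset.sum_le_sum fun i _ => ?_
        simpa [abs_mul, abs_of_nonneg ha, abs_of_nonneg hb] using abs_add_le (a * x i) (b * y i)
    _ = a * ∑ i, |x i| + b * ∑ i, |y i| := by
        rw [Finset.sum_add_distrib, Finset.mul_sum, Finset.mul_sum]
    _ ≤ a * t + b * t := by gcongr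
    _ = t := by rw [← add_mul, hab, one_mul]

theorem card_support_add_smul_sub_le {ι : Type*} [Fintype ι] (x s : EuclideanSpace ℝ ι) (γ : ℝ) :
    (Finset.univ.filter fun i => (x + γ • (s - x)) i ≠ 0).card ≤
      (Finset.univ.filter fun i => x i ≠ 0).card +
        (Finset.univ.filter fun i => s i ≠ 0).card := by
  classical
  refine (Finset.card_le_card fun i hi => ?_).trans (Finset.card_union_le _ _)
  rw [Finset.mem_filter] at hi
  by_contra h
  simp_all

/-- One conditional-gradient step contracts the primal gap by `1 - γ` up to the curvature term. -/
theorem frankWolfe_step {E : Type*} [NormedAddCommGroup E] [InnerProductSpace ℝ E]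
    [CompleteSpace E] {f : E → ℝ} (hf : ConvexOn ℝ Set.univ f) {x g s z : E}
    (hg : HasGradientAt f g x) {γ C : ℝ} (hγ : 0 ≤ γ) (hsz : ⟪s, g⟫ ≤ ⟪z, g⟫)
    (hC : f (x + γ • (s - x)) - f x - ⟪γ • (s - x), g⟫ ≤ γ ^ 2 / 2 * C) :
    f (x + γ • (s - x)) - f z ≤ (1 - γ) * (f x - f z) + γ ^ 2 / 2 * C := by
  have hz := hf.inner_gradient_le_sub hg z
  rw [real_inner_smul_left] at hC
  have hs : ⟪s - x, g⟫ ≤ f z - f x := by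
    rw [inner_sub_left] at hz ⊢
    linarith
  linarith [mul_le_mul_of_nonneg_left hs hγ]

/-- After `k + 1` conditional-gradient steps with step sizes `2 / (j + 2)`, started at the origin,
the iterate has at most `k + 1` nonzero coordinates and primal gap at most `2 * C / (k + 3)`. -/
theorem exists_sparse_gap_le_l1Ball {ι : Type*} [Fintype ι] {t : ℝ} (ht : 0 ≤ t)
    {f : EuclideanSpace ℝ ι → ℝ} {g : EuclideanSpace ℝ ι → EuclideanSpace ℝ ι}
    (hf : ConvexOn ℝ Set.univ f) (hg : ∀ x, HasGradientAt f (g x) x) {C : ℝ} (hC₀ : 0 ≤ C)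
    (hC : ∀ x ∈ {α : EuclideanSpace ℝ ι | ∑ i, |α i| ≤ t},
      ∀ s ∈ {α : EuclideanSpace ℝ ι | ∑ i, |α i| ≤ t}, ∀ γ ∈ Set.Ioc (0 : ℝ) 1,
      f (x + γ • (s - x)) - f x - ⟪γ • (s - x), g x⟫ ≤ γ ^ 2 / 2 * C) (k : ℕ) :
    ∃ x ∈ {α : EuclideanSpace ℝ ι | ∑ i, |α i| ≤ t},
      (Finset.univ.filter fun i => x i ≠ 0).card ≤ k + 1 ∧
      ∀ z ∈ {α : EuclideanSpace ℝ ι | ∑ i, |α i| ≤ t}, f x - f z ≤ 2 * C / (k + 3) := by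
  have step : ∀ x ∈ {α : EuclideanSpace ℝ ι | ∑ i, |α i| ≤ t}, ∀ γ ∈ Set.Ioc (0 : ℝ) 1,
      ∃ y ∈ {α : EuclideanSpace ℝ ι | ∑ i, |α i| ≤ t},
        (Finset.univ.filter fun i => y i ≠ 0).card ≤
          (Finset.univ.filter fun i => x i ≠ 0).card + 1 ∧
        ∀ z ∈ {α : EuclideanSpace ℝ ι | ∑ i, |α i| ≤ t},
          f y - f z ≤ (1 - γ) * (f x - f z) + γ ^ 2 / 2 * C := by
    intro x hx γ hγ
    obtain ⟨s, hs, hcard, hmin⟩ := exists_sparse_inner_minimizer_l1Ball ht (g x)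
    exact ⟨x + γ • (s - x), (convex_l1Ball t).add_smul_sub_mem hx hs ⟨hγ.1.le, hγ.2⟩,
      (card_support_add_smul_sub_le x s γ).trans (by gcongr),
      fun z hz => frankWolfe_step hf (hg x) hγ.1.le (hmin z hz) (hC x hx s hs γ hγ)⟩
  induction k with
  | zero =>
    obtain ⟨y, hy, hcard, hgap⟩ := step 0 (by simpa using ht) 1 (by simp)
    refine ⟨y, hy, by simpa using hcard, fun z hz => ?_⟩
    have := hgap z hz
    norm_num at this ⊢
    linarith
  | succ k ih =>
    obtain ⟨x, hx, hcard, hgap⟩ := ih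
    have hk : (0 : ℝ) < k + 3 := by positivity
    obtain ⟨y, hy, hcard', hgap'⟩ := step x hx (2 / (k + 3))
      ⟨by positivity, by rw [div_le_one hk]; linarith [k.cast_nonneg (α := ℝ)]⟩
    refine ⟨y, hy, by omega, fun z hz => ?_⟩
    have hcoeff : (0 : ℝ) ≤ 1 - 2 / (k + 3) := by
      rw [sub_nonneg, div_le_one hk]
      linarith [k.cast_nonneg (α := ℝ)]
    calc f y - f z ≤ (1 - 2 / (k + 3)) * (f x - f z) + (2 / (k + 3)) ^ 2 / 2 * C := hgap' z hz
      _ ≤ (1 - 2 / (k + 3)) * (2 * C / (k + 3)) + (2 / (k + 3)) ^ 2 / 2 * C := by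
        gcongr
        exact hgap z hz
      _ = 2 * C * ((k + 2) / (k + 3) ^ 2) := by
        field_simp
        ring
      _ ≤ 2 * C * (1 / (k + 4)) := by
        gcongr ?_ * ?_
        rw [div_le_div_iff₀ (by positivity) (by positivity)]
        nlinarith
      _ = 2 * C / ((k + 1 : ℕ) + 3) := by
        push_cast
        ring

/-- Sparse approximate solutions of the ℓ1-constrained Lasso problem exist with
`O(1/ε)` active features: for every `ε > 0` there is `α` in the ℓ1-ball of
radius `t` with at most `⌈4 C_f / ε⌉ + 1` nonzero coordinates such that
`f(α) − min_{β ∈ Σ} f(β) ≤ ε`. -/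
theorem lasso_sparse_approximate_solutions
    {m : ℕ} (t : ℝ) (ht : 0 < t)
    (f : EuclideanSpace ℝ (Fin m) → ℝ)
    (g : EuclideanSpace ℝ (Fin m) → EuclideanSpace ℝ (Fin m))
    (hfconv : ConvexOn ℝ Set.univ f)
    (hgrad : ∀ x, HasGradientAt f (g x) x)
    (S : Set (EuclideanSpace ℝ (Fin m)))
    (hS : S = {α : EuclideanSpace ℝ (Fin m) | ∑ i, |α i| ≤ t})
    (Cf : ℝ)
    (hCf : ∀ x ∈ S, ∀ s ∈ S, ∀ γ ∈ Set.Ioc (0:ℝ) 1,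
      f (x + γ • (s - x)) - f x - ⟪γ • (s - x), g x⟫ ≤ γ ^ 2 / 2 * Cf) :
    ∀ ε : ℝ, 0 < ε → ∃ α ∈ S,
      (Finset.univ.filter fun i => α i ≠ 0).card ≤ ⌈4 * Cf / ε⌉₊ + 1 ∧
      f α - sInf (f '' S) ≤ ε := by
  subst hS
  intro ε hε
  have hzero : (0 : EuclideanSpace ℝ (Fin m)) ∈
      {α : EuclideanSpace ℝ (Fin m) | ∑ i, |α i| ≤ t} := by
    simpa using ht.le
  have hCf₀ : 0 ≤ Cf := by
    have := hCf 0 hzero 0 hzero 1 (by simp)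
    norm_num at this
    linarith
  obtain ⟨α, hα, hcard, hgap⟩ :=
    exists_sparse_gap_le_l1Ball ht.le hfconv hgrad hCf₀ hCf ⌈4 * Cf / ε⌉₊
  have hrate : 2 * Cf / (⌈4 * Cf / ε⌉₊ + 3) ≤ ε := by
    have hceil := (div_le_iff₀ hε).mp (Nat.le_ceil (4 * Cf / ε))
    rw [div_le_iff₀ (by positivity)]
    linarith
  refine ⟨α, hα, hcard, ?_⟩
  have hinf : f α - ε ≤ sInf (f '' {α : EuclideanSpace ℝ (Fin m) | ∑ i, |α i| ≤ t}) := by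
    refine le_csInf ⟨f 0, 0, hzero, rfl⟩ ?_
    rintro _ ⟨z, hz, rfl⟩
    linarith [hgap z hz]
  linarith
end
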